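/- arXiv:0807.4061 — 7 statements merged into one kernel-verified Lean document; each statement's English description precedes it below -/
import Mathlib

section
/- Let n ∈ ℕ and let I ⊆ ℝ be an interval. Let F : I → ccR be a set-valued function whose values are nonempty compact real intervals (equivalently, F(x) = [f(x), g(x)] for functions f, g : I → ℝ with f ≤ g). Then F has a selection belonging to 𝒫ₙ (the family of polynomials of degree at most n) if and only if for every x₀, x₁, …, x_{n+1} ∈ I with x₀ < x₁ < ⋯ < x_{n+1} one has F(x₀) ∩ (Σ_{i=1}^{n+1} cᵢ(x₀; x₁,…,x_{n+1}) · F(xᵢ)) ≠ ∅, where the sum denotes the algebraic (Minkowski) sum of the scaled sets. -/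
/-- Lagrange basis coefficient: `lagC t z i = ∏_{j ≠ i} (t - z j)/(z i - z j)`. -/
noncomputable def lagC {m : ℕ} (t : ℝ) (z : Fin m → ℝ) (i : Fin m) : ℝ :=
  ∏ j ∈ Finset.univ.erase i, (t - z j) / (z i - z j)

theorem lagC_eq_eval_basis {m : ℕ} (t : ℝ) (z : Fin m → ℝ) (i : Fin m) :
    lagC t z i = (Lagrange.basis Finset.univ z i).eval t := by
  simp only [lagC, Lagrange.basis, Lagrange.basisDivisor, Polynomial.eval_prod,
    Polynomial.eval_mul, Polynomial.eval_C, Polynomial.eval_sub, Polynomial.eval_X]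
  exact Finset.prod_congr rfl fun j _ => by rw [div_eq_inv_mul]

theorem eval_interpolate_eq_sum_lagC {m : ℕ} (t : ℝ) (z a : Fin m → ℝ) :
    (Lagrange.interpolate Finset.univ z a).eval t = ∑ i, lagC t z i * a i := by
  simp [Lagrange.interpolate_apply, Polynomial.eval_finsetSum, lagC_eq_eval_basis, mul_comm]

/-- A polynomial of degree less than `m` is recovered from its values at `m` nodes. -/
theorem interpolate_eval_eq {m : ℕ} {z : Fin m → ℝ} (hz : Function.Injective z)
    {p : Polynomial ℝ} (hp : p.degree < m) :
    Lagrange.interpolate Finset.univ z (fun i => p.eval (z i)) = p :=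
  (Lagrange.eq_interpolate (s := Finset.univ) hz.injOn (by simpa using hp)).symm

theorem eval_interpolate_node {m : ℕ} {z : Fin m → ℝ} (hz : Function.Injective z)
    (a : Fin m → ℝ) (i : Fin m) :
    (Lagrange.interpolate Finset.univ z a).eval (z i) = a i :=
  Lagrange.eval_interpolate_at_node a hz.injOn (Finset.mem_univ i)

theorem degree_interpolate_univ_lt {m : ℕ} {z : Fin m → ℝ} (hz : Function.Injective z)
    (a : Fin m → ℝ) : (Lagrange.interpolate Finset.univ z a).degree < m := by
  simpa using Lagrange.degree_interpolate_lt (s := Finset.univ) a hz.injOn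

/-- On an infinite set, if any `n + 2` of the interval constraints are met by a polynomial of
degree at most `n`, then so are all of them. -/
theorem exists_polynomial_selection_of_finite {n : ℕ} {I : Set ℝ} (hI : I.Infinite) {f g : ℝ → ℝ}
    (h : ∀ s : Finset ℝ, (s : Set ℝ) ⊆ I → s.card = n + 2 →
      ∃ p : Polynomial ℝ, p.degree < (n + 1 : ℕ) ∧ ∀ x ∈ s, p.eval x ∈ Set.Icc (f x) (g x)) :
    ∃ p : Polynomial ℝ, p.degree < (n + 1 : ℕ) ∧ ∀ x ∈ I, p.eval x ∈ Set.Icc (f x) (g x) := by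
  classical
  have := hI.to_subtype
  let e : Fin (n + 1) ↪ I := Fin.valEmbedding.trans (Infinite.natEmbedding I)
  let z : Fin (n + 1) → ℝ := fun i => e i
  have hz : Function.Injective z := Subtype.val_injective.comp e.injective
  let L : ℝ → (Fin (n + 1) → ℝ) →ₗ[ℝ] ℝ := fun x =>
    Polynomial.leval x ∘ₗ Lagrange.interpolate Finset.univ z
  have hL : ∀ x v, L x v = (Lagrange.interpolate Finset.univ z v).eval x := fun _ _ => rfl
  let C : I → Set (Fin (n + 1) → ℝ) := fun x => L x ⁻¹' Set.Icc (f x) (g x)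
  have hCclosed : ∀ x, IsClosed (C x) := fun x =>
    isClosed_Icc.preimage (L x).continuous_of_finiteDimensional
  have hfin : ∀ s : Finset I, (⋂ x ∈ s, C x).Nonempty := by
    intro s
    refine Convex.helly_theorem' (𝕜 := ℝ)
      (fun x _ => (convex_Icc (f x) (g x)).linear_preimage (L x)) fun J _ hJ => ?_
    obtain ⟨T, hJT, hT⟩ := Infinite.exists_superset_card_eq J (n + 2) (by simpa using hJ)
    obtain ⟨p, hp, hpT⟩ := h (T.map (Function.Embedding.subtype _))
      (by intro x hx; simp at hx; exact hx.1) (by simpa using hT)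
    refine ⟨fun i => p.eval (z i), Set.mem_iInter₂.2 fun x hx => ?_⟩
    change L x _ ∈ Set.Icc (f x) (g x)
    rw [hL, interpolate_eval_eq hz hp]
    exact hpT x (Finset.mem_map_of_mem _ (hJT hx))
  have hbox : IsCompact (Set.univ.pi fun i => Set.Icc (f (z i)) (g (z i))) :=
    isCompact_univ_pi fun i => isCompact_Icc
  obtain ⟨v, -, hv⟩ := hbox.inter_iInter_nonempty C hCclosed fun s => by
    obtain ⟨v, hv⟩ := hfin (s ∪ Finset.univ.map e)
    rw [Set.mem_iInter₂] at hv
    refine ⟨v, fun i _ => ?_, Set.mem_iInter₂.2 fun x hx => hv x (Finset.mem_union_left _ hx)⟩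
    have := hv (e i) (Finset.mem_union_right _ (Finset.mem_map_of_mem _ (Finset.mem_univ i)))
    change L (z i) v ∈ Set.Icc (f (z i)) (g (z i)) at this
    rwa [hL, eval_interpolate_node hz] at this
  rw [Set.mem_iInter] at hv
  exact ⟨_, degree_interpolate_univ_lt hz v, fun x hx => hv ⟨x, hx⟩⟩

/-- A set-valued function `F : I → ccR`, `F x = [f x, g x]`, has a selection which is a
polynomial of degree at most `n` iff for all `x₀ < x₁ < ⋯ < x_{n+1}` in `I`,
`F(x₀) ∩ (∑ᵢ cᵢ(x₀; x₁,…,x_{n+1}) F(xᵢ)) ≠ ∅`. -/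
theorem stmt_0 (n : ℕ) (I : Set ℝ) (hI : I.OrdConnected)
    (f g : ℝ → ℝ) (hfg : ∀ x ∈ I, f x ≤ g x) :
    (∃ w : Polynomial ℝ, w.natDegree ≤ n ∧
        ∀ x ∈ I, w.eval x ∈ Set.Icc (f x) (g x)) ↔
    (∀ x : Fin (n + 2) → ℝ, (∀ i, x i ∈ I) → StrictMono x →
      (Set.Icc (f (x 0)) (g (x 0)) ∩
        {y : ℝ | ∃ a : Fin (n + 1) → ℝ,
          (∀ i, a i ∈ Set.Icc (f (x i.succ)) (g (x i.succ))) ∧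
          y = ∑ i : Fin (n + 1),
            lagC (x 0) (fun j => x j.succ) i * a i}).Nonempty) := by
  constructor
  · rintro ⟨w, hw, hsel⟩ x hx hmono
    have hz : Function.Injective fun j : Fin (n + 1) => x j.succ :=
      hmono.injective.comp (Fin.succ_injective _)
    have hdeg : w.degree < (n + 1 : ℕ) :=
      Polynomial.degree_le_natDegree.trans_lt (by exact_mod_cast Nat.lt_succ_of_le hw)
    refine ⟨w.eval (x 0), hsel _ (hx 0), fun i => w.eval (x i.succ), fun i => hsel _ (hx _), ?_⟩
    rw [← eval_interpolate_eq_sum_lagC, interpolate_eval_eq hz hdeg]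
  · intro h
    rcases I.subsingleton_or_nontrivial with hs | hnt
    · rcases hs.eq_empty_or_singleton with rfl | ⟨x, rfl⟩
      · exact ⟨0, by simp, by simp⟩
      · exact ⟨Polynomial.C (f x), by simp, by simpa using hfg x rfl⟩
    · have hinf : I.Infinite := by
        obtain ⟨a, ha, b, hb, hab⟩ := hnt.exists_lt
        exact (Set.Icc_infinite hab).mono (hI.out ha hb)
      obtain ⟨p, hp, hsel⟩ := exists_polynomial_selection_of_finite (n := n) (f := f) (g := g) hinf
        fun s hsI hs => by
          obtain ⟨y, hy, a, ha, rfl⟩ := h (s.orderEmbOfFin hs)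
            (fun i => hsI (s.orderEmbOfFin_mem hs i)) (s.orderEmbOfFin hs).strictMono
          have hz : Function.Injective fun j : Fin (n + 1) => s.orderEmbOfFin hs j.succ :=
            (s.orderEmbOfFin hs).injective.comp (Fin.succ_injective _)
          refine ⟨_, degree_interpolate_univ_lt hz a, fun x hx => ?_⟩
          obtain ⟨i, rfl⟩ : x ∈ Set.range (s.orderEmbOfFin hs) := by simpa using hx
          cases i using Fin.cases with
          | zero => rwa [eval_interpolate_eq_sum_lagC]
          | succ i => exact (eval_interpolate_node hz a i).symm ▸ ha i
      exact ⟨p, Polynomial.natDegree_le_iff_coeff_eq_zero.2 fun m hm =>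
        (Polynomial.degree_lt_iff_coeff_zero _ _).1 hp m hm, hsel⟩
end

section
/- Let I ⊆ ℝ be an interval and F : I → ccR a set-valued function whose values are nonempty compact real intervals. Then F has an affine selection (a selection of the form x ↦ ax + b) if and only if for every x, y ∈ I and every t ∈ [0,1], F(tx + (1−t)y) ∩ (tF(x) + (1−t)F(y)) ≠ ∅. -/
/-- If `f` lies below the chords of `g` and `g` lies above the chords of `f` on `I`, then some
affine function separates `f` from `g` on `I`. -/
theorem exists_affine_between {I : Set ℝ} {f g : ℝ → ℝ} (hfg : ∀ x ∈ I, f x ≤ g x)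
    (hf : ∀ x ∈ I, ∀ y ∈ I, ∀ z ∈ I, x ≤ y → y ≤ z →
      f y * (z - x) ≤ g x * (z - y) + g z * (y - x))
    (hg : ∀ x ∈ I, ∀ y ∈ I, ∀ z ∈ I, x ≤ y → y ≤ z →
      f x * (z - y) + f z * (y - x) ≤ g y * (z - x)) :
    ∃ a b : ℝ, ∀ x ∈ I, f x ≤ a * x + b ∧ a * x + b ≤ g x := by
  have slopes : ∀ x ∈ I, ∀ y ∈ I, ∀ u ∈ I, ∀ v ∈ I, y < x → u < v →
      f x * (v - u) + f u * (x - y) ≤ g y * (v - u) + g v * (x - y) := by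
    intro x hx y hy u hu v hv hyx huv
    rcases le_total u y with huy | hyu <;> rcases le_total x v with hxv | hvx
    · linarith [hg u hu y hy x hx huy hyx.le, hf y hy x hx v hv hyx.le hxv]
    · have h₁ := mul_le_mul_of_nonneg_right (hg u hu y hy x hx huy hyx.le) (sub_nonneg.2 huv.le)
      have h₂ := mul_le_mul_of_nonneg_right (hg u hu v hv x hx huv.le hvx) (sub_nonneg.2 hyx.le)
      refine le_of_mul_le_mul_right ?_ (sub_pos.2 (huv.trans_le hvx))
      linarith
    · have h₁ := mul_le_mul_of_nonneg_right (hf y hy u hu v hv hyu huv.le) (sub_nonneg.2 hyx.le)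
      have h₂ := mul_le_mul_of_nonneg_right (hf y hy x hx v hv hyx.le hxv) (sub_nonneg.2 huv.le)
      refine le_of_mul_le_mul_right ?_ (sub_pos.2 (hyx.trans_le hxv))
      linarith
    · linarith [hf y hy u hu v hv hyu huv.le, hg u hu v hv x hx huv.le hvx]
  rcases I.eq_empty_or_nonempty with rfl | ⟨w, hw⟩
  · simp
  by_cases hI : I.Subsingleton
  · exact ⟨0, f w, fun x hx ↦ by simp [hI hx hw, hfg w hw]⟩
  obtain ⟨p, hp, q, hq, hpq⟩ := (Set.not_subsingleton_iff.1 hI).exists_lt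
  obtain ⟨a, ha₁, ha₂⟩ : (upperBounds {r | ∃ x ∈ I, ∃ y ∈ I, y < x ∧ r = (f x - g y) / (x - y)} ∩
      lowerBounds {r | ∃ u ∈ I, ∃ v ∈ I, u < v ∧ r = (g v - f u) / (v - u)}).Nonempty := by
    refine exists_between_of_forall_le ⟨_, q, hq, p, hp, hpq, rfl⟩ ⟨_, p, hp, q, hq, hpq, rfl⟩ ?_
    rintro _ ⟨x, hx, y, hy, hyx, rfl⟩ _ ⟨u, hu, v, hv, huv, rfl⟩
    rw [div_le_div_iff₀ (sub_pos.2 hyx) (sub_pos.2 huv)]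
    linarith [slopes x hx y hy u hu v hv hyx huv]
  obtain ⟨b, hb₁, hb₂⟩ : (upperBounds ((fun x ↦ f x - a * x) '' I) ∩
      lowerBounds ((fun x ↦ g x - a * x) '' I)).Nonempty := by
    refine exists_between_of_forall_le ⟨_, w, hw, rfl⟩ ⟨_, w, hw, rfl⟩ ?_
    rintro _ ⟨x, hx, rfl⟩ _ ⟨y, hy, rfl⟩
    rcases lt_trichotomy x y with h | rfl | h
    · have := (le_div_iff₀ (sub_pos.2 h)).1 (ha₂ ⟨x, hx, y, hy, h, rfl⟩)
      dsimp only
      linarith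
    · exact sub_le_sub_right (hfg x hx) _
    · have := (div_le_iff₀ (sub_pos.2 h)).1 (ha₁ ⟨x, hx, y, hy, h, rfl⟩)
      dsimp only
      linarith
  refine ⟨a, b, fun x hx ↦ ⟨?_, ?_⟩⟩
  · linarith [hb₁ ⟨x, hx, rfl⟩]
  · linarith [hb₂ ⟨x, hx, rfl⟩]


/-- A set-valued function `F : I → ccR`, `F x = [f x, g x]`, has an affine selection
`x ↦ a*x + b` iff for all `x, y ∈ I` and `t ∈ [0,1]`,
`F(t*x + (1-t)*y) ∩ (t*F(x) + (1-t)*F(y)) ≠ ∅`. -/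
theorem stmt_1 (I : Set ℝ) (hI : I.OrdConnected)
    (f g : ℝ → ℝ) (hfg : ∀ x ∈ I, f x ≤ g x) :
    (∃ a b : ℝ, ∀ x ∈ I, a * x + b ∈ Set.Icc (f x) (g x)) ↔
    (∀ x ∈ I, ∀ y ∈ I, ∀ t ∈ Set.Icc (0 : ℝ) 1,
      (Set.Icc (f (t * x + (1 - t) * y)) (g (t * x + (1 - t) * y)) ∩
        {z : ℝ | ∃ p ∈ Set.Icc (f x) (g x), ∃ q ∈ Set.Icc (f y) (g y),
          z = t * p + (1 - t) * q}).Nonempty) := by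
  constructor
  · rintro ⟨a, b, h⟩ x hx y hy t ht
    have hmem : t * x + (1 - t) * y ∈ I :=
      hI.convex hx hy ht.1 (sub_nonneg.2 ht.2) (by ring)
    exact ⟨_, h _ hmem, a * x + b, h x hx, a * y + b, h y hy, by ring⟩
  · intro h
    have chord : ∀ x ∈ I, ∀ y ∈ I, ∀ z ∈ I, x ≤ y → y ≤ z →
        f y * (z - x) ≤ g x * (z - y) + g z * (y - x) ∧
          f x * (z - y) + f z * (y - x) ≤ g y * (z - x) := by
      intro x hx y _ z hz hxy hyz
      rcases (hxy.trans hyz).eq_or_lt with rfl | hxz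
      · simp [le_antisymm hxy hyz]
      have hpos : 0 < z - x := sub_pos.2 hxz
      obtain ⟨t, ht⟩ : ∃ t, t * (z - x) = z - y := ⟨_, div_mul_cancel₀ _ hpos.ne'⟩
      have ht₀ : 0 ≤ t := nonneg_of_mul_nonneg_left (ht ▸ sub_nonneg.2 hyz) hpos
      have ht₁ : 0 ≤ 1 - t := nonneg_of_mul_nonneg_left (b := z - x) (by linarith) hpos
      obtain ⟨_, hr, p, hp, q, hq, rfl⟩ := h x hx z hz t ⟨ht₀, sub_nonneg.1 ht₁⟩
      rw [show t * x + (1 - t) * z = y by linarith] at hr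
      rw [show y - x = (1 - t) * (z - x) by linarith, ← ht]
      have hp₁ := mul_le_mul_of_nonneg_left hp.1 ht₀
      have hp₂ := mul_le_mul_of_nonneg_left hp.2 ht₀
      have hq₁ := mul_le_mul_of_nonneg_left hq.1 ht₁
      have hq₂ := mul_le_mul_of_nonneg_left hq.2 ht₁
      constructor
      · have : f y ≤ t * g x + (1 - t) * g z := by linarith [hr.1]
        linarith [mul_le_mul_of_nonneg_right this hpos.le]
      · have : t * f x + (1 - t) * f z ≤ g y := by linarith [hr.2]
        linarith [mul_le_mul_of_nonneg_right this hpos.le]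
    exact exists_affine_between hfg
      (fun x hx y hy z hz hxy hyz ↦ (chord x hx y hy z hz hxy hyz).1)
      (fun x hx y hy z hz hxy hyz ↦ (chord x hx y hy z hz hxy hyz).2)
end

section
/- Let I ⊆ ℝ be an interval and f, g : I → ℝ. The following conditions are equivalent: (i) there exists an affine function h : I → ℝ such that f(x) ≤ h(x) ≤ g(x) for all x ∈ I; (ii) for every x, y ∈ I and every t ∈ [0,1], f(tx + (1−t)y) ≤ t g(x) + (1−t) g(y) and g(tx + (1−t)y) ≥ t f(x) + (1−t) f(y). -/
/-- If `g` lies above all chords of `f` on `I`, then the line through `(x, f x)` and `(y, f y)`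
lies below `g` between `x` and `y`. -/
lemma exists_line_through_le {I : Set ℝ} {f g : ℝ → ℝ}
    (h : ∀ x ∈ I, ∀ y ∈ I, ∀ t ∈ Set.Icc (0 : ℝ) 1,
      t * f x + (1 - t) * f y ≤ g (t * x + (1 - t) * y))
    {x y : ℝ} (hx : x ∈ I) (hy : y ∈ I) :
    ∃ a b : ℝ, f x = a * x + b ∧ f y = a * y + b ∧ ∀ w ∈ Set.uIcc x y, a * w + b ≤ g w := by
  have hline : ∃ a b : ℝ, f x = a * x + b ∧ f y = a * y + b := by
    rcases eq_or_ne x y with rfl | hxy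
    · exact ⟨0, f x, by ring, by ring⟩
    · have : y - x ≠ 0 := sub_ne_zero.mpr hxy.symm
      refine ⟨(f y - f x) / (y - x), f x - (f y - f x) / (y - x) * x, by ring, ?_⟩
      field_simp
      ring
  obtain ⟨a, b, hfx, hfy⟩ := hline
  refine ⟨a, b, hfx, hfy, fun w hw => ?_⟩
  rw [← segment_eq_uIcc] at hw
  obtain ⟨s, t, hs, ht, hst, rfl⟩ := hw
  obtain rfl : t = 1 - s := by linarith
  have := h x hx y hy s ⟨hs, by linarith⟩
  rw [hfx, hfy] at this
  simp only [smul_eq_mul]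
  linarith

/-- Every lower bound for a separating slope is at most every upper bound. -/
lemma slope_bounds_le {I : Set ℝ} {f g : ℝ → ℝ}
    (hfg : ∀ x ∈ I, ∀ y ∈ I, ∀ t ∈ Set.Icc (0 : ℝ) 1,
      f (t * x + (1 - t) * y) ≤ t * g x + (1 - t) * g y)
    (hgf : ∀ x ∈ I, ∀ y ∈ I, ∀ t ∈ Set.Icc (0 : ℝ) 1,
      t * f x + (1 - t) * f y ≤ g (t * x + (1 - t) * y))
    {x y u v : ℝ} (hx : x ∈ I) (hy : y ∈ I) (hu : u ∈ I) (hv : v ∈ I) (hyx : y < x) (huv : u < v) :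
    (f x - g y) / (x - y) ≤ (g v - f u) / (v - u) := by
  obtain ⟨a, b, hfx, hfu, hF⟩ := exists_line_through_le hgf hx hu
  obtain ⟨c, d, hgv, hgy, hG⟩ : ∃ c d : ℝ, g v = c * v + d ∧ g y = c * y + d ∧
      ∀ w ∈ Set.uIcc v y, f w ≤ c * w + d := by
    obtain ⟨c, d, h₁, h₂, h₃⟩ := exists_line_through_le (f := -g) (g := -f)
      (fun x hx y hy t ht => by
        have := hfg x hx y hy t ht
        simp only [Pi.neg_apply]
        linarith) hv hy
    simp only [Pi.neg_apply] at h₁ h₂ h₃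
    exact ⟨-c, -d, by linarith, by linarith, fun w hw => by linarith [h₃ w hw]⟩
  have hX : x ∈ Set.uIcc v y → a * x + b ≤ c * x + d := fun h => hfx ▸ hG x h
  have hU : u ∈ Set.uIcc v y → a * u + b ≤ c * u + d := fun h => hfu ▸ hG u h
  have hV : v ∈ Set.uIcc x u → a * v + b ≤ c * v + d := fun h => hgv ▸ hF v h
  have hY : y ∈ Set.uIcc x u → a * y + b ≤ c * y + d := fun h => hgy ▸ hF y h
  have hp : 0 < v - u := sub_pos.mpr huv
  have hq : 0 < x - y := sub_pos.mpr hyx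
  obtain ⟨z, hz⟩ : ∃ z, (v - u + (x - y)) * z = (v - u) * x + (x - y) * u :=
    ⟨_, mul_div_cancel₀ _ (by positivity)⟩
  have hpq : 0 < v - u + (x - y) := by positivity
  rw [Set.mem_uIcc] at hX hU hV hY
  have key : a * z + b ≤ c * z + d := by
    have between : ∀ l r, l ≤ z → z ≤ r → a * l + b ≤ c * l + d → a * r + b ≤ c * r + d →
        a * z + b ≤ c * z + d := by
      intro l r hl hr h₁ h₂
      rcases le_total a c with h | h <;> nlinarith
    have zle : ∀ r, x ≤ r → u ≤ r → z ≤ r := fun _ h₁ h₂ => by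
      refine le_of_mul_le_mul_left ?_ hpq
      nlinarith
    have lez : ∀ l, l ≤ x → l ≤ u → l ≤ z := fun _ h₁ h₂ => by
      refine le_of_mul_le_mul_left ?_ hpq
      nlinarith
    have zle' : ∀ r, v ≤ r → y ≤ r → z ≤ r := fun _ h₁ h₂ => by
      refine le_of_mul_le_mul_left ?_ hpq
      nlinarith
    have lez' : ∀ l, l ≤ v → l ≤ y → l ≤ z := fun _ h₁ h₂ => by
      refine le_of_mul_le_mul_left ?_ hpq
      nlinarith
    have hl : ∃ l ≤ z, a * l + b ≤ c * l + d := by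
      rcases le_total x u with h₁ | h₁ <;> rcases le_total v y with h₂ | h₂
      · linarith
      · rcases le_total x y with h₃ | h₃
        · linarith
        · exact ⟨x, lez x le_rfl h₁, hX (by grind)⟩
      · rcases le_total u v with h₃ | h₃
        · exact ⟨v, lez' v le_rfl h₂, hV (by grind)⟩
        · linarith
      · rcases le_total u y with h₃ | h₃
        · exact ⟨y, lez' y h₂ le_rfl, hY (by grind)⟩
        · exact ⟨u, lez u h₁ le_rfl, hU (by grind)⟩
    have hr : ∃ r, z ≤ r ∧ a * r + b ≤ c * r + d := by
      rcases le_total x u with h₁ | h₁ <;> rcases le_total v y with h₂ | h₂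
      · linarith
      · exact ⟨u, zle u h₁ le_rfl, hU (by grind)⟩
      · exact ⟨y, zle' y h₂ le_rfl, hY (by grind)⟩
      · rcases le_total x v with h₃ | h₃
        · exact ⟨x, zle x le_rfl h₁, hX (by grind)⟩
        · exact ⟨v, zle' v le_rfl h₂, hV (by grind)⟩
    obtain ⟨l, hlz, hl⟩ := hl
    obtain ⟨r, hzr, hr⟩ := hr
    exact between l r hlz hzr hl hr
  rw [div_le_div_iff₀ hq hp, hfx, hfu, hgv, hgy]
  have := mul_le_mul_of_nonneg_left key hpq.le
  linear_combination this + (c - a) * hz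

/-- `f, g : I → ℝ` can be separated by an affine function `x ↦ a*x + b` iff
for all `x, y ∈ I` and `t ∈ [0,1]`, `f(t*x+(1-t)*y) ≤ t*g(x)+(1-t)*g(y)` and
`g(t*x+(1-t)*y) ≥ t*f(x)+(1-t)*f(y)`. -/
theorem stmt_3 (I : Set ℝ) (hI : I.OrdConnected) (f g : ℝ → ℝ) :
    (∃ a b : ℝ, ∀ x ∈ I, f x ≤ a * x + b ∧ a * x + b ≤ g x) ↔
    (∀ x ∈ I, ∀ y ∈ I, ∀ t ∈ Set.Icc (0 : ℝ) 1,
      f (t * x + (1 - t) * y) ≤ t * g x + (1 - t) * g y ∧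
      g (t * x + (1 - t) * y) ≥ t * f x + (1 - t) * f y) := by
  constructor
  · rintro ⟨a, b, h⟩ x hx y hy t ⟨ht₀, ht₁⟩
    have hmem : t * x + (1 - t) * y ∈ I :=
      hI.convex hx hy ht₀ (sub_nonneg.mpr ht₁) (by ring)
    have hz := h _ hmem
    have hs : 0 ≤ 1 - t := sub_nonneg.mpr ht₁
    have h₁ := mul_le_mul_of_nonneg_left (h x hx).1 ht₀
    have h₂ := mul_le_mul_of_nonneg_left (h x hx).2 ht₀
    have h₃ := mul_le_mul_of_nonneg_left (h y hy).1 hs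
    have h₄ := mul_le_mul_of_nonneg_left (h y hy).2 hs
    constructor <;> linarith
  · intro h
    have hfg := fun x hx y hy t ht => (h x hx y hy t ht).1
    have hgf := fun x hx y hy t ht => (h x hx y hy t ht).2
    have hle : ∀ x ∈ I, f x ≤ g x := fun x hx => by
      simpa using hfg x hx x hx 1 (by simp)
    obtain ⟨a, ha⟩ : ∃ a : ℝ, ∀ x ∈ I, ∀ y ∈ I, f x - a * x ≤ g y - a * y := by
      rcases I.subsingleton_or_nontrivial with hs | hn
      · refine ⟨0, fun x hx y hy => ?_⟩
        rw [hs hy hx]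
        linarith [hle x hx]
      · obtain ⟨p, hp, q, hq, hpq⟩ := hn.exists_lt
        obtain ⟨a, ha₁, ha₂⟩ := exists_between_of_forall_le
          (s := {m | ∃ x ∈ I, ∃ y ∈ I, y < x ∧ (f x - g y) / (x - y) = m})
          (t := {m | ∃ u ∈ I, ∃ v ∈ I, u < v ∧ (g v - f u) / (v - u) = m})
          ⟨_, q, hq, p, hp, hpq, rfl⟩ ⟨_, p, hp, q, hq, hpq, rfl⟩ (by
            rintro _ ⟨x, hx, y, hy, hyx, rfl⟩ _ ⟨u, hu, v, hv, huv, rfl⟩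
            exact slope_bounds_le hfg hgf hx hy hu hv hyx huv)
        refine ⟨a, fun x hx y hy => ?_⟩
        rcases lt_trichotomy x y with hxy | rfl | hxy
        · have := ha₂ ⟨x, hx, y, hy, hxy, rfl⟩
          rw [le_div_iff₀ (sub_pos.mpr hxy)] at this
          linarith
        · linarith [hle x hx]
        · have := ha₁ ⟨x, hx, y, hy, hxy, rfl⟩
          rw [div_le_iff₀ (sub_pos.mpr hxy)] at this
          linarith
    rcases I.eq_empty_or_nonempty with rfl | hne
    · exact ⟨0, 0, by simp⟩
    obtain ⟨b, hb₁, hb₂⟩ := exists_between_of_forall_le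
      (hne.image fun x => f x - a * x) (hne.image fun y => g y - a * y) (by
        rintro _ ⟨x, hx, rfl⟩ _ ⟨y, hy, rfl⟩
        exact ha x hx y hy)
    refine ⟨a, b, fun x hx => ⟨?_, ?_⟩⟩
    · linarith [hb₁ (Set.mem_image_of_mem _ hx)]
    · linarith [hb₂ (Set.mem_image_of_mem _ hx)]
end

section
/- Let n ∈ ℕ and let I ⊆ ℝ be an interval. If f : I → ℝ is n-convex, g : I → ℝ is n-concave, and f(x) ≤ g(x) for all x ∈ I, then there exists a polynomial w of degree at most n such that f(x) ≤ w(x) ≤ g(x) for all x ∈ I. -/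
/-- `f` is `n`-convex on `I`: for all `x₀ < x₁ < ⋯ < x_{n+1}` in `I`,
`(-1)^n f(x₀) ≤ (-1)^n ∑ᵢ cᵢ(x₀; x₁,…,x_{n+1}) f(xᵢ)`. -/
def NConvexOn (n : ℕ) (I : Set ℝ) (f : ℝ → ℝ) : Prop :=
  ∀ x : Fin (n + 2) → ℝ, (∀ i, x i ∈ I) → StrictMono x →
    (-1 : ℝ) ^ n * f (x 0) ≤
      (-1 : ℝ) ^ n * ∑ i : Fin (n + 1), lagC (x 0) (fun j => x j.succ) i * f (x i.succ)

/-- `f` is `n`-concave on `I` iff `-f` is `n`-convex on `I`. -/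
def NConcaveOn (n : ℕ) (I : Set ℝ) (f : ℝ → ℝ) : Prop :=
  NConvexOn n I (fun t => -f t)

open Polynomial in
theorem eval_interpolate_univ_eq_sum_lagC {m : ℕ} (t : ℝ) (z r : Fin m → ℝ) :
    (Lagrange.interpolate Finset.univ z r).eval t = ∑ i, lagC t z i * r i := by
  simp only [Lagrange.interpolate_apply, eval_finsetSum, eval_mul, eval_C, Lagrange.basis,
    eval_prod, Lagrange.basisDivisor, eval_sub, eval_X, lagC]
  refine Finset.sum_congr rfl fun i _ => ?_
  rw [mul_comm]
  congr 1
  exact Finset.prod_congr rfl fun j _ => by rw [div_eq_inv_mul]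

theorem natDegree_interpolate_le {ι : Type*} [DecidableEq ι] {n : ℕ} {s : Finset ι} {v : ι → ℝ}
    (hv : Set.InjOn v s) (hs : s.card ≤ n + 1) (r : ι → ℝ) :
    (Lagrange.interpolate s v r).natDegree ≤ n :=
  (Polynomial.natDegree_le_of_degree_le (Lagrange.degree_interpolate_le r hv)).trans (by omega)

/-- A convex combination of a nonnegative and a nonpositive number can be made to vanish. -/
theorem exists_convex_combination_eq_zero {a b : ℝ} (ha : 0 ≤ a) (hb : b ≤ 0) :
    ∃ t : ℝ, 0 ≤ t ∧ t ≤ 1 ∧ (1 - t) * a + t * b = 0 := by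
  rcases eq_or_lt_of_le (sub_nonneg.2 (hb.trans ha)) with h | h
  · exact ⟨0, le_rfl, zero_le_one, by linarith⟩
  · refine ⟨a / (a - b), by positivity, (div_le_one h).2 (by linarith), ?_⟩
    field_simp
    ring

/-- Separation at `n + 2` ordered points: some convex combination of `f` and `g` has vanishing
divided difference there, so it is interpolated by a polynomial of degree at most `n`. -/
theorem exists_polynomial_between_on_range {n : ℕ} {I : Set ℝ} {f g : ℝ → ℝ}
    (hf : NConvexOn n I f) (hg : NConcaveOn n I g) (hfg : ∀ x ∈ I, f x ≤ g x)
    {x : Fin (n + 2) → ℝ} (hxI : ∀ i, x i ∈ I) (hx : StrictMono x) :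
    ∃ w : Polynomial ℝ, w.natDegree ≤ n ∧ ∀ i, f (x i) ≤ w.eval (x i) ∧ w.eval (x i) ≤ g (x i) := by
  have hF := hf x hxI hx
  have hG := hg x hxI hx
  simp only [mul_neg, Finset.sum_neg_distrib] at hG
  set z : Fin (n + 1) → ℝ := fun j => x j.succ
  obtain ⟨t, ht0, ht1, ht⟩ := exists_convex_combination_eq_zero
    (sub_nonneg.2 hF) (sub_nonpos.2 (neg_le_neg_iff.1 hG))
  set h : ℝ → ℝ := fun y => (1 - t) * f y + t * g y with hh
  have hsum : ∑ i, lagC (x 0) z i * h (x i.succ) = h (x 0) := by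
    have hlin : ∑ i, lagC (x 0) z i * h (x i.succ) =
        (1 - t) * ∑ i, lagC (x 0) z i * f (x i.succ) +
          t * ∑ i, lagC (x 0) z i * g (x i.succ) := by
      rw [Finset.mul_sum, Finset.mul_sum, ← Finset.sum_add_distrib]
      exact Finset.sum_congr rfl fun i _ => by simp only [hh]; ring
    rw [hlin]
    apply mul_left_cancel₀ (pow_ne_zero n (neg_ne_zero.2 one_ne_zero) : (-1 : ℝ) ^ n ≠ 0)
    simp only [hh]
    linear_combination ht
  have hinj : Set.InjOn z (Finset.univ : Finset (Fin (n + 1))) :=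
    fun i _ j _ hij => Fin.succ_injective _ (hx.injective hij)
  refine ⟨Lagrange.interpolate Finset.univ z fun i => h (x i.succ),
    natDegree_interpolate_le hinj (by simp) _, fun i => ?_⟩
  have heval : (Lagrange.interpolate Finset.univ z fun i => h (x i.succ)).eval (x i) = h (x i) := by
    refine Fin.cases ?_ (fun j => ?_) i
    · rw [eval_interpolate_univ_eq_sum_lagC, hsum]
    · exact Lagrange.eval_interpolate_at_node _ hinj (Finset.mem_univ j)
  rw [heval]
  have := hfg _ (hxI i)
  constructor <;> simp only [hh] <;> nlinarith

theorem exists_polynomial_between_on_finset {n : ℕ} {I : Set ℝ} {f g : ℝ → ℝ}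
    (hf : NConvexOn n I f) (hg : NConcaveOn n I g) (hfg : ∀ x ∈ I, f x ≤ g x)
    {s : Finset ℝ} (hsI : ∀ x ∈ s, x ∈ I) (hs : s.card ≤ n + 2) :
    ∃ w : Polynomial ℝ, w.natDegree ≤ n ∧ ∀ x ∈ s, f x ≤ w.eval x ∧ w.eval x ≤ g x := by
  rcases Nat.lt_or_ge s.card (n + 2) with h | h
  · have hinj : Set.InjOn (id : ℝ → ℝ) s := Function.injective_id.injOn
    refine ⟨Lagrange.interpolate s id f, natDegree_interpolate_le hinj (by omega) f,
      fun x hx => ?_⟩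
    have heval : (Lagrange.interpolate s id f).eval x = f x :=
      Lagrange.eval_interpolate_at_node f hinj hx
    exact ⟨heval.ge, heval.trans_le (hfg x (hsI x hx))⟩
  · have hcard : s.card = n + 2 := le_antisymm hs h
    obtain ⟨w, hw, hwx⟩ := exists_polynomial_between_on_range hf hg hfg
      (x := s.orderEmbOfFin hcard) (fun i => hsI _ (s.orderEmbOfFin_mem hcard i))
      (s.orderEmbOfFin hcard).strictMono
    refine ⟨w, hw, fun x hx => ?_⟩
    obtain ⟨i, rfl⟩ : x ∈ Set.range (s.orderEmbOfFin hcard) := by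
      rwa [s.range_orderEmbOfFin hcard]
    exact hwx i

/-- Helly-type principle: if `f` and `g` are separated by a polynomial of degree at most `n` on
every set of at most `n + 2` points of `I`, then they are so separated on all of `I`. -/
theorem exists_polynomial_between_of_finset {n : ℕ} {I : Set ℝ} {f g : ℝ → ℝ}
    (H : ∀ s : Finset ℝ, (∀ x ∈ s, x ∈ I) → s.card ≤ n + 2 →
      ∃ w : Polynomial ℝ, w.natDegree ≤ n ∧ ∀ x ∈ s, f x ≤ w.eval x ∧ w.eval x ≤ g x) :
    ∃ w : Polynomial ℝ, w.natDegree ≤ n ∧ ∀ x ∈ I, f x ≤ w.eval x ∧ w.eval x ≤ g x := by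
  classical
  by_cases hI : ∃ s : Finset ℝ, (s : Set ℝ) ⊆ I ∧ s.card = n + 1
  · obtain ⟨s, hsI, hs⟩ := hI
    let z : Fin (n + 1) → ℝ := ⇑(s.orderEmbOfFin hs)
    have hzI : ∀ i, z i ∈ I := fun i => hsI (s.orderEmbOfFin_mem hs i)
    have hinj : Set.InjOn z (Finset.univ : Finset (Fin (n + 1))) :=
      (s.orderEmbOfFin hs).injective.injOn
    let L (x : ℝ) : (Fin (n + 1) → ℝ) →ₗ[ℝ] ℝ :=
      Polynomial.leval x ∘ₗ Lagrange.interpolate Finset.univ z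
    let K (x : I) : Set (Fin (n + 1) → ℝ) := L x ⁻¹' Set.Icc (f x) (g x)
    have hconv (x : I) : Convex ℝ (K x) := (convex_Icc _ _).linear_preimage (L x)
    have hclosed (x : I) : IsClosed (K x) :=
      isClosed_Icc.preimage (L x).continuous_of_finiteDimensional
    have hnode (i : Fin (n + 1)) (v : Fin (n + 1) → ℝ) : L (z i) v = v i :=
      Lagrange.eval_interpolate_at_node v hinj (Finset.mem_univ i)
    have hfin (u : Finset I) : (⋂ x ∈ u, K x).Nonempty := by
      refine Convex.helly_theorem' (𝕜 := ℝ) (fun x _ => hconv x) fun J _ hJ => ?_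
      obtain ⟨w, hw, hwJ⟩ := H (J.map (Function.Embedding.subtype _))
        (by simp only [Finset.mem_map]; rintro _ ⟨y, _, rfl⟩; exact y.2) (by simpa using hJ)
      refine ⟨fun i => w.eval (z i), Set.mem_iInter₂.2 fun x hx => ?_⟩
      have hdeg : w.degree < (Finset.univ : Finset (Fin (n + 1))).card := by
        rw [Finset.card_univ, Fintype.card_fin]
        exact (Polynomial.degree_le_of_natDegree_le hw).trans_lt (by exact_mod_cast n.lt_succ_self)
      have hL : L x (fun i => w.eval (z i)) = w.eval (x : ℝ) :=
        congrArg (Polynomial.eval (x : ℝ)) (Lagrange.eq_interpolate hinj hdeg).symm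
      change L x (fun i => w.eval (z i)) ∈ Set.Icc _ _
      rw [hL]
      exact hwJ x (Finset.mem_map_of_mem _ hx)
    have hcompact : IsCompact (Set.univ.pi fun i => Set.Icc (f (z i)) (g (z i))) :=
      isCompact_univ_pi fun i => isCompact_Icc
    obtain ⟨v, -, hv⟩ := hcompact.inter_iInter_nonempty K hclosed fun u => by
      obtain ⟨v, hv⟩ := hfin (u ∪ Finset.univ.image fun i => (⟨z i, hzI i⟩ : I))
      rw [Set.mem_iInter₂] at hv
      refine ⟨v, fun i _ => ?_, Set.mem_iInter₂.2 fun x hx => hv x (Finset.mem_union_left _ hx)⟩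
      have hi : L (z i) v ∈ Set.Icc (f (z i)) (g (z i)) := hv ⟨z i, hzI i⟩
        (Finset.mem_union_right _ (Finset.mem_image_of_mem _ (Finset.mem_univ i)))
      rwa [hnode] at hi
    exact ⟨Lagrange.interpolate Finset.univ z v, natDegree_interpolate_le hinj (by simp) v,
      fun x hx => Set.mem_iInter.1 hv ⟨x, hx⟩⟩
  · have hfinite : I.Finite := by
      by_contra hinf
      exact hI (Set.Infinite.exists_subset_card_eq hinf (n + 1))
    have hcard : hfinite.toFinset.card ≤ n + 2 := by
      by_contra! hlt
      obtain ⟨s, hs, hsc⟩ := Finset.exists_subset_card_eq (show n + 1 ≤ hfinite.toFinset.card by omega)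
      exact hI ⟨s, fun x hx => hfinite.mem_toFinset.1 (hs hx), hsc⟩
    obtain ⟨w, hw, hwI⟩ := H _ (fun x => hfinite.mem_toFinset.1) hcard
    exact ⟨w, hw, fun x hx => hwI x (hfinite.mem_toFinset.2 hx)⟩

/-- If `f` is `n`-convex, `g` is `n`-concave and `f ≤ g` on the interval `I`, then
some polynomial of degree at most `n` separates `f` from `g` on `I`. -/
theorem stmt_4 (n : ℕ) (I : Set ℝ) (hI : I.OrdConnected) (f g : ℝ → ℝ)
    (hf : NConvexOn n I f) (hg : NConcaveOn n I g)
    (hfg : ∀ x ∈ I, f x ≤ g x) :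
    ∃ w : Polynomial ℝ, w.natDegree ≤ n ∧
      ∀ x ∈ I, f x ≤ w.eval x ∧ w.eval x ≤ g x := by
  exact exists_polynomial_between_of_finset fun _ => exists_polynomial_between_on_finset hf hg hfg
end

section
/- Let n ∈ ℕ, ε > 0, let I ⊆ ℝ be an interval, and let f : I → ℝ. If for every x₀, x₁, …, x_{n+1} ∈ I with x₀ ≤ x₁ < x₂ < ⋯ < x_{n+1} one has |f(x₀) − Σ_{i=1}^{n+1} cᵢ(x₀; x₁,…,x_{n+1}) f(xᵢ)| ≤ ε, then there exists a polynomial w of degree at most n such that |f(x) − w(x)| ≤ ε/2 for all x ∈ I. -/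
theorem eval_interpolate_univ {m : ℕ} (z r : Fin m → ℝ) (t : ℝ) :
    (Lagrange.interpolate Finset.univ z r).eval t = ∑ i, lagC t z i * r i := by
  rw [Lagrange.interpolate_apply, Polynomial.eval_finsetSum]
  refine Finset.sum_congr rfl fun i _ => ?_
  rw [Polynomial.eval_mul, Polynomial.eval_C, mul_comm, Lagrange.basis, Polynomial.eval_prod, lagC]
  congr 1
  refine Finset.prod_congr rfl fun j _ => ?_
  simp only [Lagrange.basisDivisor, Polynomial.eval_mul, Polynomial.eval_C, Polynomial.eval_sub,
    Polynomial.eval_X]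
  ring

/-- Shifting the interpolant at `x₁, …, xₙ₊₁` by half of its error at `x₀` balances the errors. -/
theorem exists_near_of_interpolation_error_le {n : ℕ} {ε : ℝ} {f : ℝ → ℝ} (x : Fin (n + 2) → ℝ)
    (hx : Function.Injective fun i : Fin (n + 1) => x i.succ)
    (h : |f (x 0) - ∑ i : Fin (n + 1),
      lagC (x 0) (fun j => x j.succ) i * f (x i.succ)| ≤ ε) :
    ∃ w : Polynomial ℝ, w.degree < (n + 1 : ℕ) ∧ ∀ i, |f (x i) - w.eval (x i)| ≤ ε / 2 := by
  rw [← eval_interpolate_univ (fun j => x j.succ) (fun j => f (x j.succ))] at h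
  have hdeg := Lagrange.degree_interpolate_lt (s := Finset.univ)
    (fun j : Fin (n + 1) => f (x j.succ)) hx.injOn
  have hval (i : Fin (n + 1)) := Lagrange.eval_interpolate_at_node (s := Finset.univ)
    (fun j : Fin (n + 1) => f (x j.succ)) hx.injOn (Finset.mem_univ i)
  set L := Lagrange.interpolate Finset.univ (fun j : Fin (n + 1) => x j.succ)
    (fun j => f (x j.succ))
  rw [Finset.card_univ, Fintype.card_fin] at hdeg
  refine ⟨L + Polynomial.C ((f (x 0) - L.eval (x 0)) / 2),
    (Polynomial.degree_add_le _ _).trans_lt (max_lt hdeg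
      (Polynomial.degree_C_le.trans_lt (by exact_mod_cast n.succ_pos))), ?_⟩
  have h' := abs_le.1 h
  refine Fin.cases ?_ fun i => ?_
  · rw [Polynomial.eval_add, Polynomial.eval_C, abs_le]
    constructor <;> linarith
  · rw [Polynomial.eval_add, Polynomial.eval_C, hval i, abs_le]
    constructor <;> linarith

/-- Helly's theorem for uniform approximation of a function on a finite set by polynomials. -/
theorem exists_near_finset_of_card_le {d : ℕ} {δ : ℝ} {f : ℝ → ℝ} {S : Finset ℝ}
    (h : ∀ T ⊆ S, T.card ≤ d + 1 →
      ∃ w : Polynomial ℝ, w.degree < d ∧ ∀ x ∈ T, |f x - w.eval x| ≤ δ) :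
    ∃ w : Polynomial ℝ, w.degree < d ∧ ∀ x ∈ S, |f x - w.eval x| ≤ δ := by
  let e := Polynomial.degreeLTEquiv ℝ d
  have : Module.Finite ℝ (Polynomial.degreeLT ℝ d) := Module.Finite.equiv e.symm
  have hrank : Module.finrank ℝ (Polynomial.degreeLT ℝ d) = d := by
    rw [e.finrank_eq, Module.finrank_fin_fun]
  let F : ℝ → Set (Polynomial.degreeLT ℝ d) := fun x =>
    {w | |f x - (w : Polynomial ℝ).eval x| ≤ δ}
  have hF : ∀ x ∈ S, Convex ℝ (F x) := by
    intro x _ v hv w hw a b ha hb hab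
    simp only [F, Set.mem_ofPred_eq, abs_le] at hv hw ⊢
    have hsum : ((a • v + b • w : Polynomial.degreeLT ℝ d) : Polynomial ℝ).eval x =
        a * (v : Polynomial ℝ).eval x + b * (w : Polynomial ℝ).eval x := by simp
    obtain rfl : a = 1 - b := by linarith
    rw [hsum]
    constructor
    · nlinarith [mul_le_mul_of_nonneg_left hv.1 ha, mul_le_mul_of_nonneg_left hw.1 hb]
    · nlinarith [mul_le_mul_of_nonneg_left hv.2 ha, mul_le_mul_of_nonneg_left hw.2 hb]
  obtain ⟨w, hw⟩ := Convex.helly_theorem' (𝕜 := ℝ) hF fun T hT hcard => by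
    obtain ⟨w, hw, hwT⟩ := h T hT (hrank ▸ hcard)
    exact ⟨⟨w, Polynomial.mem_degreeLT.2 hw⟩, by simpa [F] using hwT⟩
  exact ⟨w, Polynomial.mem_degreeLT.1 w.2, by simpa [F] using hw⟩

/-- Approximability on finite subsets passes to any set with enough points, by compactness. -/
theorem exists_near_of_forall_finset {d : ℕ} {δ : ℝ} {f : ℝ → ℝ} {s : Set ℝ} {p : Fin d → ℝ}
    (hp : Function.Injective p) (hps : ∀ i, p i ∈ s)
    (h : ∀ S : Finset ℝ, ↑S ⊆ s →
      ∃ w : Polynomial ℝ, w.degree < d ∧ ∀ x ∈ S, |f x - w.eval x| ≤ δ) :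
    ∃ w : Polynomial ℝ, w.degree < d ∧ ∀ x ∈ s, |f x - w.eval x| ≤ δ := by
  classical
  obtain ⟨v, -, hv⟩ := (isCompact_Icc (a := fun i => f (p i) - δ)
      (b := fun i => f (p i) + δ)).inter_iInter_nonempty
    (fun x : s => {v : Fin d → ℝ | |f x - ∑ i, lagC x p i * v i| ≤ δ})
    (fun x => isClosed_le (by fun_prop) continuous_const) fun u => by
      obtain ⟨w, hdeg, hw⟩ := h (u.image (↑) ∪ Finset.univ.image p) (by
        intro x hx
        simp only [Finset.coe_union, Finset.coe_image, Set.mem_union, Set.mem_image] at hx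
        rcases hx with ⟨y, -, rfl⟩ | ⟨i, -, rfl⟩
        exacts [y.2, hps i])
      have hwp (i : Fin d) := abs_le.1 (hw (p i) (by simp))
      refine ⟨fun i => w.eval (p i), ⟨fun i => ?_, fun i => ?_⟩, ?_⟩
      · dsimp only
        linarith [hwp i]
      · dsimp only
        linarith [hwp i]
      · simp only [Set.mem_iInter, Set.mem_ofPred_eq]
        intro x hx
        rw [← eval_interpolate_univ, ← Lagrange.eq_interpolate hp.injOn (by simpa using hdeg)]
        exact hw x (Finset.mem_union_left _ (Finset.mem_image_of_mem _ hx))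
  refine ⟨Lagrange.interpolate Finset.univ p v, ?_, fun x hx => ?_⟩
  · simpa using Lagrange.degree_interpolate_lt (s := Finset.univ) v hp.injOn
  · rw [eval_interpolate_univ]
    exact Set.mem_iInter.1 hv ⟨x, hx⟩

/-- Hyers–Ulam type stability: if `|f(x₀) - ∑ᵢ cᵢ(x₀; x₁,…,x_{n+1}) f(xᵢ)| ≤ ε` for all
`x₀ ≤ x₁ < x₂ < ⋯ < x_{n+1}` in `I`, then `f` is uniformly `ε/2`-close on `I` to some
polynomial of degree at most `n`. -/
theorem stmt_6 (n : ℕ) (ε : ℝ) (hε : 0 < ε) (I : Set ℝ) (hI : I.OrdConnected)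
    (f : ℝ → ℝ)
    (h : ∀ x : Fin (n + 2) → ℝ, (∀ i, x i ∈ I) → x 0 ≤ x 1 →
      StrictMono (fun i : Fin (n + 1) => x i.succ) →
      |f (x 0) - ∑ i : Fin (n + 1), lagC (x 0) (fun j => x j.succ) i * f (x i.succ)| ≤ ε) :
    ∃ w : Polynomial ℝ, w.natDegree ≤ n ∧ ∀ x ∈ I, |f x - w.eval x| ≤ ε / 2 := by
  suffices ∃ w : Polynomial ℝ, w.degree < (n + 1 : ℕ) ∧ ∀ x ∈ I, |f x - w.eval x| ≤ ε / 2 by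
    obtain ⟨w, hdeg, hw⟩ := this
    exact ⟨w, Polynomial.natDegree_le_iff_coeff_eq_zero.2 fun m hm =>
      (Polynomial.degree_lt_iff_coeff_zero _ _).1 hdeg m hm, hw⟩
  rcases I.subsingleton_or_nontrivial with hsub | hnt
  · rcases hsub.eq_empty_or_singleton with rfl | ⟨a, rfl⟩
    · exact ⟨0, by simp⟩
    · refine ⟨Polynomial.C (f a),
        Polynomial.degree_C_le.trans_lt (by exact_mod_cast n.succ_pos), ?_⟩
      rintro x rfl
      simpa using (half_pos hε).le
  have hinf : I.Infinite := by
    obtain ⟨a, ha, b, hb, hab⟩ := hnt.exists_lt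
    exact (Set.Icc_infinite hab).mono (hI.out ha hb)
  have := hinf.to_subtype
  let p : Fin (n + 1) → ℝ := fun i => (Infinite.natEmbedding I i : ℝ)
  have hp : Function.Injective p := fun i j hij =>
    Fin.ext ((Infinite.natEmbedding I).injective (Subtype.ext hij))
  refine exists_near_of_forall_finset hp (fun i => (Infinite.natEmbedding I i).2) fun S hS =>
    exists_near_finset_of_card_le fun T hT hcard => ?_
  rcases hcard.lt_or_eq with hlt | heq
  · refine ⟨Lagrange.interpolate T id f, (Lagrange.degree_interpolate_lt f
      Function.injective_id.injOn).trans_le (by exact_mod_cast Nat.lt_succ_iff.1 hlt),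
      fun x hx => ?_⟩
    have := Lagrange.eval_interpolate_at_node f (Function.injective_id.injOn (s := (T : Set ℝ))) hx
    rw [id] at this
    rw [this, sub_self, abs_zero]
    exact (half_pos hε).le
  · let x := T.orderEmbOfFin heq
    have hmono : StrictMono fun i : Fin (n + 1) => x i.succ :=
      x.strictMono.comp (Fin.strictMono_succ)
    obtain ⟨w, hdeg, hw⟩ := exists_near_of_interpolation_error_le x hmono.injective
      (h x (fun i => hS (hT (T.orderEmbOfFin_mem heq i))) (x.monotone (Fin.zero_le _)) hmono)
    refine ⟨w, hdeg, fun y hy => ?_⟩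
    obtain ⟨i, rfl⟩ : y ∈ Set.range x := by rwa [Finset.range_orderEmbOfFin]
    exact hw i
end

section
/- Let n ∈ ℕ with n ≥ 1 and let x₀ < x₁ < ⋯ < x_{n+1} be real numbers. Set Lᵢ = cᵢ(x₀; x₁,…,x_{n+1}) for i = 1,…,n+1, and set Mᵢ = cᵢ(xₙ; x₀,x₁,…,x_{n−1},x_{n+1}) for i ∈ {0,1,…,n−1,n+1} (the Lagrange basis coefficients at xₙ with respect to the n+1 nodes x₀, x₁, …, x_{n−1}, x_{n+1}, indexed by the nodes). Then M₀Lₙ = 1 and M₀Lᵢ + Mᵢ = 0 for every i ∈ {1,…,n−1,n+1}. -/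
open Finset in
/-- The Lagrange coefficients for the nodes `x j`, `j ≠ a`, as products over the full index set. -/
theorem lagC_succAbove {m : ℕ} (t : ℝ) (x : Fin (m + 1) → ℝ) (a : Fin (m + 1)) (i : Fin m) :
    lagC t (fun j => x (a.succAbove j)) i =
      ∏ j ∈ (univ.erase a).erase (a.succAbove i), (t - x j) / (x (a.succAbove i) - x j) := by
  have h : (univ.erase a).erase (a.succAbove i) = (univ.erase i).image a.succAbove := by
    rw [image_erase Fin.succAbove_right_injective, Fin.image_succAbove_univ,
      compl_singleton]
  rw [h, prod_image Fin.succAbove_right_injective.injOn, lagC]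

open Finset in
/-- Exchanging the evaluation point with a node inverts the coefficient of that node. -/
theorem lagC_mul_lagC_exchange {m : ℕ} {x : Fin (m + 1) → ℝ} (hx : Function.Injective x)
    {a b : Fin (m + 1)} {p q : Fin m} (hp : a.succAbove p = b) (hq : b.succAbove q = a) :
    lagC (x b) (fun j => x (b.succAbove j)) q * lagC (x a) (fun j => x (a.succAbove j)) p = 1 := by
  rw [lagC_succAbove, lagC_succAbove, hp, hq, erase_right_comm, ← prod_mul_distrib]
  refine prod_eq_one fun j hj => ?_
  simp only [mem_erase, mem_univ, and_true] at hj
  have h₁ : x a - x j ≠ 0 := sub_ne_zero.2 fun h => by simp [hx h] at hj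
  have h₂ : x b - x j ≠ 0 := sub_ne_zero.2 fun h => by simp [hx h] at hj
  field_simp

open Finset in
/-- The effect on the coefficient of a third node `x c` of exchanging the evaluation point `x a`
with the node `x b`. -/
theorem lagC_mul_lagC_add_lagC_exchange {m : ℕ} {x : Fin (m + 1) → ℝ}
    (hx : Function.Injective x) {a b c : Fin (m + 1)} {p q r : Fin m} (hab : a ≠ b)
    (hp : a.succAbove p = c) (hq : b.succAbove q = a) (hr : b.succAbove r = c) :
    lagC (x b) (fun j => x (b.succAbove j)) q * lagC (x a) (fun j => x (a.succAbove j)) p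
      + lagC (x b) (fun j => x (b.succAbove j)) r = 0 := by
  have hca : c ≠ a := hp ▸ Fin.succAbove_ne a p
  have hcb : c ≠ b := hr ▸ Fin.succAbove_ne b r
  rw [lagC_succAbove, lagC_succAbove, lagC_succAbove, hp, hq, hr]
  set T : Finset (Fin (m + 1)) := ((univ.erase a).erase b).erase c with hT
  have e₁ : (univ.erase b).erase a = insert c T := by
    rw [hT, insert_erase (by simp [hca, hcb]), erase_right_comm]
  have e₂ : (univ.erase a).erase c = insert b T := by
    rw [hT, erase_right_comm (a := b), insert_erase (by simp [hcb.symm, hab.symm])]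
  have e₃ : (univ.erase b).erase c = insert a T := by
    rw [hT, erase_right_comm (a := a), erase_right_comm (a := a),
      insert_erase (by simp [hca.symm, hab])]
  rw [e₁, e₂, e₃, prod_insert (by simp [hT]), prod_insert (by simp [hT]),
    prod_insert (by simp [hT])]
  have hprod : (∏ j ∈ T, (x b - x j) / (x a - x j)) * ∏ j ∈ T, (x a - x j) / (x c - x j) =
      ∏ j ∈ T, (x b - x j) / (x c - x j) := by
    rw [← prod_mul_distrib]
    refine prod_congr rfl fun j hj => ?_
    have h : x a - x j ≠ 0 := sub_ne_zero.2 fun h => by simp [hT, hx h] at hj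
    exact div_mul_div_cancel₀ h
  rw [← hprod]
  have h₁ : x a - x c ≠ 0 := sub_ne_zero.2 (hx.ne hca.symm)
  have h₂ : x c - x b ≠ 0 := sub_ne_zero.2 (hx.ne hcb)
  have h₃ : x c - x a ≠ 0 := sub_ne_zero.2 (hx.ne hca)
  field_simp
  ring

/-- Let `x₀ < x₁ < ⋯ < x_{n+1}`, `Lᵢ = cᵢ(x₀; x₁,…,x_{n+1})` for `i = 1,…,n+1`
(here `L` is indexed by `Fin (n+1)`, index `k` standing for the paper's `i = k+1`)
and `Mᵢ = cᵢ(xₙ; x₀,x₁,…,x_{n-1},x_{n+1})` for `i ∈ {0,1,…,n-1,n+1}` (here `M` is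
indexed by the positions `0,…,n` in the node list `x₀, x₁, …, x_{n-1}, x_{n+1}`, the
last position `n` standing for the node `x_{n+1}`). Then `M₀Lₙ = 1` and
`M₀Lᵢ + Mᵢ = 0` for `i ∈ {1,…,n-1,n+1}`. -/
theorem stmt_10 (n : ℕ) (hn : 1 ≤ n) (x : Fin (n + 2) → ℝ) (hx : StrictMono x)
    (L : Fin (n + 1) → ℝ) (hL : ∀ i, L i = lagC (x 0) (fun j => x j.succ) i)
    (z : Fin (n + 1) → ℝ)
    (hz : ∀ j : Fin (n + 1),
      z j = if h : (j : ℕ) < n then x ⟨(j : ℕ), by omega⟩ else x ⟨n + 1, by omega⟩)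
    (M : Fin (n + 1) → ℝ) (hM : ∀ j, M j = lagC (x ⟨n, by omega⟩) z j) :
    M 0 * L ⟨n - 1, by omega⟩ = 1 ∧
    (∀ j : Fin (n + 1), 1 ≤ (j : ℕ) → (j : ℕ) ≤ n - 1 →
      M 0 * L ⟨(j : ℕ) - 1, by omega⟩ + M j = 0) ∧
    M 0 * L ⟨n, by omega⟩ + M ⟨n, by omega⟩ = 0 := by
  have hz' : z = fun j => x ((⟨n, by omega⟩ : Fin (n + 2)).succAbove j) := by
    funext j
    rw [hz]
    split_ifs with h <;> congr 1 <;> ext <;> simp [Fin.succAbove, Fin.lt_def, h]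
    omega
  have hL' : ∀ i, L i = lagC (x 0) (fun j => x ((0 : Fin (n + 2)).succAbove j)) i := by
    simpa using hL
  have hq : (⟨n, by omega⟩ : Fin (n + 2)).succAbove 0 = 0 := by
    ext; simp [Fin.succAbove, Fin.lt_def, Nat.pos_iff_ne_zero]; omega
  have hab : (0 : Fin (n + 2)) ≠ ⟨n, by omega⟩ := by
    simp [Fin.ext_iff]; omega
  simp only [hM, hL', hz']
  refine ⟨lagC_mul_lagC_exchange hx.injective ?_ hq, fun j hj₁ hj₂ =>
    lagC_mul_lagC_add_lagC_exchange (c := j.castSucc) hx.injective hab ?_ hq ?_,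
    lagC_mul_lagC_add_lagC_exchange (c := Fin.last _) hx.injective hab ?_ hq ?_⟩
  · ext; simp; omega
  · ext; simp; omega
  · exact Fin.succAbove_of_castSucc_lt _ _ (by simp [Fin.lt_def]; omega)
  · ext; simp
  · ext; simp [Fin.succAbove]
end

section
/- Define f, g : [0,1] → ℝ by f(x) = x/2 for 0 ≤ x < 1, f(1) = 1, and g(x) = x for 0 ≤ x < 1, g(1) = 1/2. Then f and g satisfy the separation inequalities (4) for n = 1, i.e., for all x₀, x₁, x₂ ∈ [0,1] with x₀ ≤ x₁ < x₂ one has f(x₀) ≤ c₁(x₀; x₁,x₂) g(x₁) + c₂(x₀; x₁,x₂) f(x₂) and g(x₀) ≥ c₁(x₀; x₁,x₂) f(x₁) + c₂(x₀; x₁,x₂) g(x₂); nevertheless f(1) > g(1), and there is no affine function h : [0,1] → ℝ with f(x) ≤ h(x) ≤ g(x) for all x ∈ [0,1]. -/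
/-- The function `f(x) = x/2` for `x ≠ 1`, `f(1) = 1`. -/
noncomputable def fEx : ℝ → ℝ := fun x => if x = 1 then 1 else x / 2

/-- The function `g(x) = x` for `x ≠ 1`, `g(1) = 1/2`. -/
noncomputable def gEx : ℝ → ℝ := fun x => if x = 1 then 1 / 2 else x

theorem fEx_one : fEx 1 = 1 := by simp [fEx]

theorem gEx_one : gEx 1 = 1 / 2 := by simp [gEx]

theorem fEx_of_lt_one {x : ℝ} (hx : x < 1) : fEx x = x / 2 := by simp [fEx, hx.ne]

theorem gEx_of_lt_one {x : ℝ} (hx : x < 1) : gEx x = x := by simp [gEx, hx.ne]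

theorem affine_extrapolation_eq (x₀ x₁ x₂ u v : ℝ) :
    (x₀ - x₂) / (x₁ - x₂) * u + (x₀ - x₁) / (x₂ - x₁) * v =
      ((x₂ - x₀) * u + (x₀ - x₁) * v) / (x₂ - x₁) := by
  rw [← neg_sub x₂ x₀, ← neg_sub x₂ x₁, neg_div_neg_eq]
  ring

/-- The pair `fEx, gEx` on `[0,1]` satisfies the separation inequalities `(4)` for `n = 1`
(with `c₁(x₀;x₁,x₂) = (x₀-x₂)/(x₁-x₂)` and `c₂(x₀;x₁,x₂) = (x₀-x₁)/(x₂-x₁)`), yet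
`fEx 1 > gEx 1` and no affine function separates `fEx` from `gEx` on `[0,1]`. -/
theorem stmt_11 :
    (∀ x₀ ∈ Set.Icc (0 : ℝ) 1, ∀ x₁ ∈ Set.Icc (0 : ℝ) 1, ∀ x₂ ∈ Set.Icc (0 : ℝ) 1,
      x₀ ≤ x₁ → x₁ < x₂ →
      fEx x₀ ≤ (x₀ - x₂) / (x₁ - x₂) * gEx x₁ + (x₀ - x₁) / (x₂ - x₁) * fEx x₂ ∧
      gEx x₀ ≥ (x₀ - x₂) / (x₁ - x₂) * fEx x₁ + (x₀ - x₁) / (x₂ - x₁) * gEx x₂) ∧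
    fEx 1 > gEx 1 ∧
    ¬ ∃ a b : ℝ, ∀ x ∈ Set.Icc (0 : ℝ) 1, fEx x ≤ a * x + b ∧ a * x + b ≤ gEx x := by
  refine ⟨?_, ?_, ?_⟩
  · rintro x₀ ⟨h₀, -⟩ x₁ ⟨h₁, -⟩ x₂ ⟨-, h₂⟩ h₀₁ h₁₂
    have hd : 0 < x₂ - x₁ := sub_pos.2 h₁₂
    have hx₁ : x₁ < 1 := h₁₂.trans_le h₂
    have hx₀ : x₀ < 1 := h₀₁.trans_lt hx₁
    rw [affine_extrapolation_eq, affine_extrapolation_eq, ge_iff_le,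
      le_div_iff₀ hd, div_le_iff₀ hd, fEx_of_lt_one hx₀, gEx_of_lt_one hx₀,
      fEx_of_lt_one hx₁, gEx_of_lt_one hx₁]
    rcases h₂.eq_or_lt with rfl | h₂
    · rw [fEx_one, gEx_one]
      have := mul_nonneg h₀ hd.le
      constructor <;> linarith
    · rw [fEx_of_lt_one h₂, gEx_of_lt_one h₂]
      have := mul_nonneg (sub_nonneg.2 (h₀₁.trans h₁₂.le)) h₁
      constructor <;> linarith
  · rw [fEx_one, gEx_one]
    norm_num
  · rintro ⟨a, b, h⟩
    have h1 := h 1 (by simp)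
    rw [fEx_one, gEx_one] at h1
    linarith [h1.1, h1.2]
end
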